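/- arXiv:2109.05356 — 8 statements merged into one kernel-verified Lean document; each statement's English description precedes it below -/
import Mathlib

section
/- Let f, g : ℝⁿ → ℝ be differentiable with gradients ∇f, ∇g (Euclidean inner product), let λ > 0, σ ∈ (0,1), L_g ≥ 0, and let t₀ < t₁. Let x : ℝ → ℝⁿ be differentiable on [t₀,t₁] with x′(t) = −λ(∇f(x(t)) + ∇g(xᵏ)) for all t ∈ [t₀,t₁], where xᵏ = x(t₀). Define z(t) = ∇f(x(t)) + ∇g(xᵏ). If for all t ∈ [t₀,t₁] one has ‖∇g(x(t)) − ∇g(xᵏ)‖ ≤ L_g‖x(t) − xᵏ‖ and L_g‖x(t) − xᵏ‖ ≤ σ‖z(t)‖, then for every t ∈ [t₀,t₁] the derivative of t ↦ f(x(t)) + g(x(t)) is at most −λ(1−σ)‖z(t)‖². -/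
theorem stmt2 (n : ℕ) (f g : EuclideanSpace ℝ (Fin n) → ℝ)
    (f' g' : EuclideanSpace ℝ (Fin n) → EuclideanSpace ℝ (Fin n))
    (hf : ∀ y, HasGradientAt f (f' y) y) (hg : ∀ y, HasGradientAt g (g' y) y)
    (lam σ Lg : ℝ) (hlam : 0 < lam) (hσ : σ ∈ Set.Ioo (0 : ℝ) 1) (hLg : 0 ≤ Lg)
    (t₀ t₁ : ℝ) (ht : t₀ < t₁) (x : ℝ → EuclideanSpace ℝ (Fin n))
    (hx : ∀ t ∈ Set.Icc t₀ t₁,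
      HasDerivAt x (-lam • (f' (x t) + g' (x t₀))) t)
    (hLip : ∀ t ∈ Set.Icc t₀ t₁,
      ‖g' (x t) - g' (x t₀)‖ ≤ Lg * ‖x t - x t₀‖)
    (htrig : ∀ t ∈ Set.Icc t₀ t₁,
      Lg * ‖x t - x t₀‖ ≤ σ * ‖f' (x t) + g' (x t₀)‖) :
    ∀ t ∈ Set.Icc t₀ t₁,
      deriv (fun s => f (x s) + g (x s)) t
        ≤ -lam * (1 - σ) * ‖f' (x t) + g' (x t₀)‖ ^ 2 := by
  intro t htt
  have hderiv := ((hf (x t)).hasFDerivAt.comp_hasDerivAt t (hx t htt)).add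
    ((hg (x t)).hasFDerivAt.comp_hasDerivAt t (hx t htt))
  have heq : deriv (fun s => f (x s) + g (x s)) t = _ := hderiv.deriv
  rw [heq]
  simp only [InnerProductSpace.toDual_apply_apply]
  rw [← inner_add_left, inner_smul_right]
  set z := f' (x t) + g' (x t₀) with hz
  set d := g' (x t) - g' (x t₀) with hd
  have hsum : f' (x t) + g' (x t) = z + d := by rw [hz, hd]; abel
  have hdz : ‖d‖ ≤ σ * ‖z‖ := (hLip t htt).trans (htrig t htt)
  have hinner : -(‖d‖ * ‖z‖) ≤ inner ℝ d z :=
    (abs_le.mp (abs_real_inner_le_norm d z)).1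
  have hmul : ‖d‖ * ‖z‖ ≤ σ * ‖z‖ * ‖z‖ := by gcongr
  have hlow : (1 - σ) * ‖z‖ ^ 2 ≤ ‖z‖ ^ 2 + inner ℝ d z := by linarith
  rw [hsum, inner_add_left, real_inner_self_eq_norm_sq]
  linarith [mul_le_mul_of_nonneg_left hlow hlam.le]
end

section
/- Let f, g : ℝⁿ → ℝ be differentiable with gradients ∇f, ∇g (Euclidean inner product), let λ > 0, σ ∈ (0,1), L_g ≥ 0, and let t₀ < t₁. Let x : ℝ → ℝⁿ be differentiable on [t₀,t₁] with x′(t) = −λ(∇f(x(t)) + ∇g(xᵏ)) for all t ∈ [t₀,t₁], where xᵏ = x(t₀). If for all t ∈ [t₀,t₁] one has ‖∇g(x(t)) − ∇g(xᵏ)‖ ≤ L_g‖x(t) − xᵏ‖ and L_g‖x(t) − xᵏ‖ ≤ σ‖∇f(x(t)) + ∇g(xᵏ)‖, then the map t ↦ f(x(t)) + g(x(t)) is nonincreasing on [t₀,t₁]; in particular x(t) remains in the sublevel set {y ∈ ℝⁿ : f(y) + g(y) ≤ f(xᵏ) + g(xᵏ)} for all t ∈ [t₀,t₁]. -/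
/-- A perturbation of `a` of norm at most `‖a‖` keeps a nonnegative inner product with `a`. -/
theorem inner_add_left_nonneg_of_norm_le {E : Type*} [NormedAddCommGroup E]
    [InnerProductSpace ℝ E] {a d : E} (h : ‖d‖ ≤ ‖a‖) : 0 ≤ inner ℝ (a + d) a := by
  rw [inner_add_left, real_inner_self_eq_norm_sq]
  have h₁ := neg_le_of_abs_le (abs_real_inner_le_norm d a)
  nlinarith [mul_le_mul_of_nonneg_right h (norm_nonneg a)]

/-- The chain rule for a real function along a curve, in terms of its gradient. -/
theorem HasGradientAt.hasDerivAt_comp {E : Type*} [NormedAddCommGroup E]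
    [InnerProductSpace ℝ E] [CompleteSpace E] {f : E → ℝ} {x : ℝ → E} {v w : E} {t : ℝ}
    (hf : HasGradientAt f v (x t)) (hx : HasDerivAt x w t) :
    HasDerivAt (fun s => f (x s)) (inner ℝ v w) t := by
  simpa [Function.comp_def] using hf.hasFDerivAt.comp_hasDerivAt t hx

theorem stmt3 (n : ℕ) (f g : EuclideanSpace ℝ (Fin n) → ℝ)
    (f' g' : EuclideanSpace ℝ (Fin n) → EuclideanSpace ℝ (Fin n))
    (hf : ∀ y, HasGradientAt f (f' y) y) (hg : ∀ y, HasGradientAt g (g' y) y)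
    (lam σ Lg : ℝ) (hlam : 0 < lam) (hσ : σ ∈ Set.Ioo (0 : ℝ) 1) (hLg : 0 ≤ Lg)
    (t₀ t₁ : ℝ) (ht : t₀ < t₁) (x : ℝ → EuclideanSpace ℝ (Fin n))
    (hx : ∀ t ∈ Set.Icc t₀ t₁,
      HasDerivAt x (-lam • (f' (x t) + g' (x t₀))) t)
    (hLip : ∀ t ∈ Set.Icc t₀ t₁,
      ‖g' (x t) - g' (x t₀)‖ ≤ Lg * ‖x t - x t₀‖)
    (htrig : ∀ t ∈ Set.Icc t₀ t₁,
      Lg * ‖x t - x t₀‖ ≤ σ * ‖f' (x t) + g' (x t₀)‖) :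
    AntitoneOn (fun t => f (x t) + g (x t)) (Set.Icc t₀ t₁) ∧
      ∀ t ∈ Set.Icc t₀ t₁,
        x t ∈ {y : EuclideanSpace ℝ (Fin n) | f y + g y ≤ f (x t₀) + g (x t₀)} := by
  have hderiv : ∀ t ∈ Set.Icc t₀ t₁, HasDerivAt (fun s => f (x s) + g (x s))
      (inner ℝ (f' (x t)) (-lam • (f' (x t) + g' (x t₀))) +
        inner ℝ (g' (x t)) (-lam • (f' (x t) + g' (x t₀)))) t := fun t htI =>
    ((hf (x t)).hasDerivAt_comp (hx t htI)).add ((hg (x t)).hasDerivAt_comp (hx t htI))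
  have hanti : AntitoneOn (fun t => f (x t) + g (x t)) (Set.Icc t₀ t₁) := by
    refine antitoneOn_of_hasDerivWithinAt_nonpos (convex_Icc t₀ t₁)
      (fun t htI => (hderiv t htI).continuousAt.continuousWithinAt)
      (fun t htI => (hderiv t (interior_subset htI)).hasDerivWithinAt) fun t htI => ?_
    have htI := interior_subset htI
    have hd : ‖g' (x t) - g' (x t₀)‖ ≤ ‖f' (x t) + g' (x t₀)‖ :=
      ((hLip t htI).trans (htrig t htI)).trans
        (mul_le_of_le_one_left (norm_nonneg _) hσ.2.le)
    have hnn := inner_add_left_nonneg_of_norm_le hd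
    rw [add_add_sub_cancel] at hnn
    rw [← inner_add_left, real_inner_smul_right]
    exact mul_nonpos_of_nonpos_of_nonneg (neg_nonpos.mpr hlam.le) hnn
  exact ⟨hanti, fun t htI => hanti (Set.left_mem_Icc.mpr ht.le) htI htI.1⟩
end

section
/- Let φ : ℝ → ℝ be twice continuously differentiable, let c ∈ ℝ, λ > 0, H > 0, and t₀ < t₁. Let x : ℝ → ℝ be differentiable on [t₀,t₁] with x′(t) = −λ(φ′(x(t)) + c) for all t ∈ [t₀,t₁], and suppose φ″(x(t)) ≤ H for all t ∈ [t₀,t₁]. Define z(t) = φ′(x(t)) + c. Then for all t ∈ [t₀,t₁], |x(t) − x(t₀)| ≤ |z(t)| · (e^{λH(t−t₀)} − 1)/H. -/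
/-- If `z' = -a z` with `a ≤ K`, then `|z|` decays at rate at most `K`. -/
theorem abs_le_abs_mul_exp_of_hasDerivAt_neg_mul {z a : ℝ → ℝ} {K t₀ t₁ : ℝ}
    (hz : ∀ t ∈ Set.Icc t₀ t₁, HasDerivAt z (-(a t * z t)) t)
    (ha : ∀ t ∈ Set.Icc t₀ t₁, a t ≤ K) {s t : ℝ} (hs : s ∈ Set.Icc t₀ t₁)
    (ht : t ∈ Set.Icc t₀ t₁) (hst : s ≤ t) :
    |z s| ≤ |z t| * Real.exp (K * (t - s)) := by
  have hderiv : ∀ r ∈ Set.Icc t₀ t₁, HasDerivAt (fun r => (z r * Real.exp (K * r)) ^ 2)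
      (2 * (K - a r) * (z r * Real.exp (K * r)) ^ 2) r := by
    intro r hr
    have hexp : HasDerivAt (fun r => Real.exp (K * r)) (Real.exp (K * r) * (K * 1)) r :=
      ((hasDerivAt_id r).const_mul K).exp
    refine (((hz r hr).mul hexp).pow 2).congr_deriv ?_
    simp only [Pi.mul_apply]
    push_cast
    ring
  have hmono : MonotoneOn (fun r => (z r * Real.exp (K * r)) ^ 2) (Set.Icc t₀ t₁) := by
    refine monotoneOn_of_deriv_nonneg (convex_Icc _ _)
      (fun r hr => (hderiv r hr).continuousAt.continuousWithinAt)
      (fun r hr => (hderiv r (interior_subset hr)).differentiableAt.differentiableWithinAt)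
      fun r hr => ?_
    rw [(hderiv r (interior_subset hr)).deriv]
    have := ha r (interior_subset hr)
    exact mul_nonneg (by linarith) (sq_nonneg _)
  have h := sq_le_sq.mp (hmono hs ht hst)
  rw [abs_mul, abs_mul, Real.abs_exp, Real.abs_exp] at h
  rw [mul_sub, Real.exp_sub, ← mul_div_assoc]
  exact (le_div_iff₀ (Real.exp_pos _)).mpr h

theorem stmt6 (φ : ℝ → ℝ) (hφ : ContDiff ℝ 2 φ) (c lam H t₀ t₁ : ℝ)
    (hlam : 0 < lam) (hH : 0 < H) (ht : t₀ < t₁) (x : ℝ → ℝ)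
    (hx : ∀ t ∈ Set.Icc t₀ t₁, HasDerivAt x (-lam * (deriv φ (x t) + c)) t)
    (hbound : ∀ t ∈ Set.Icc t₀ t₁, deriv (deriv φ) (x t) ≤ H) :
    ∀ t ∈ Set.Icc t₀ t₁,
      |x t - x t₀| ≤ |deriv φ (x t) + c| * (Real.exp (lam * H * (t - t₀)) - 1) / H := by
  intro t htm
  have hφ' : Differentiable ℝ (deriv φ) := hφ.differentiable_deriv_two
  have hz : ∀ s ∈ Set.Icc t₀ t₁, HasDerivAt (fun s => deriv φ (x s) + c)
      (-(lam * deriv (deriv φ) (x s) * (deriv φ (x s) + c))) s := by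
    intro s hs
    exact (((hφ' (x s)).hasDerivAt.comp s (hx s hs)).add_const c).congr_deriv (by ring)
  have hsub : ∀ s ∈ Set.Icc t₀ t, s ∈ Set.Icc t₀ t₁ := fun s hs => ⟨hs.1, hs.2.trans htm.2⟩
  set Z := |deriv φ (x t) + c|
  have hB : ∀ s, HasDerivAt
      (fun s => Z * (Real.exp (lam * H * (t - t₀)) - Real.exp (lam * H * (t - s))) / H)
      (lam * (Z * Real.exp (lam * H * (t - s)))) s := by
    intro s
    have hexp : HasDerivAt (fun s => Real.exp (lam * H * (t - s)))
        (Real.exp (lam * H * (t - s)) * (lam * H * -1)) s :=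
      (((hasDerivAt_id s).const_sub t).const_mul (lam * H)).exp
    exact (((hexp.const_sub _).const_mul Z).div_const H).congr_deriv (by field_simp)
  have key := image_norm_le_of_norm_deriv_right_le_deriv_boundary
    (f := fun s => x s - x t₀) (a := t₀) (b := t)
    (fun s hs => ((hx s (hsub s hs)).sub_const _).continuousAt.continuousWithinAt)
    (fun s hs => ((hx s (hsub s (Set.Ico_subset_Icc_self hs))).sub_const _).hasDerivWithinAt)
    (by simp) hB
    (fun s hs => by
      have hs' := hsub s (Set.Ico_subset_Icc_self hs)
      rw [Real.norm_eq_abs, abs_mul, abs_neg, abs_of_pos hlam]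
      exact mul_le_mul_of_nonneg_left
        (abs_le_abs_mul_exp_of_hasDerivAt_neg_mul hz
          (fun r hr => mul_le_mul_of_nonneg_left (hbound r hr) hlam.le) hs' htm hs.2.le) hlam.le)
    (Set.right_mem_Icc.mpr htm.1)
  simpa using key
end

section
/- Let E be a real inner product space that is a complete normed space, let Ω ⊆ E be a nonempty closed convex set, let x ∈ Ω, w, e ∈ E, λ > 0, and σ ∈ (0,1). Define z̄ = P_Ω(x − λw) − x, where P_Ω denotes the metric projection onto Ω. If λ‖e‖ ≤ σ‖z̄‖, then ⟨w + e, z̄⟩ ≤ −((1−σ)/λ)‖z̄‖². -/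
open RealInnerProductSpace

/-- Variational inequality for a nearest point `p` of a convex set. -/
theorem real_inner_sub_sub_nonpos_of_forall_norm_le {E : Type*} [NormedAddCommGroup E]
    [InnerProductSpace ℝ E] {K : Set E} (hK : Convex ℝ K) {u p : E} (hp : p ∈ K)
    (hmin : ∀ v ∈ K, ‖u - p‖ ≤ ‖u - v‖) {v : E} (hv : v ∈ K) : ⟪u - p, v - p⟫ ≤ 0 := by
  refine (norm_eq_iInf_iff_real_inner_le_zero hK hp).1 ?_ v hv
  have : Nonempty K := ⟨⟨p, hp⟩⟩
  refine le_antisymm (le_ciInf fun v => hmin v v.2) (ciInf_le ?_ (⟨p, hp⟩ : K))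
  exact ⟨0, by rintro _ ⟨v, rfl⟩; exact norm_nonneg _⟩

theorem stmt9 {E : Type*} [NormedAddCommGroup E] [InnerProductSpace ℝ E]
    [CompleteSpace E]
    (Ω : Set E) (hne : Ω.Nonempty) (hcl : IsClosed Ω) (hconv : Convex ℝ Ω)
    (P : E → E) (hPmem : ∀ u, P u ∈ Ω)
    (hPproj : ∀ u, ∀ v ∈ Ω, ‖u - P u‖ ≤ ‖u - v‖)
    (x : E) (hx : x ∈ Ω) (w e : E) (lam σ : ℝ) (hlam : 0 < lam)
    (hσ : σ ∈ Set.Ioo (0 : ℝ) 1)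
    (htrig : lam * ‖e‖ ≤ σ * ‖P (x - lam • w) - x‖) :
    ⟪w + e, P (x - lam • w) - x⟫ ≤ -((1 - σ) / lam) * ‖P (x - lam • w) - x‖ ^ 2 := by
  have hvar := real_inner_sub_sub_nonpos_of_forall_norm_le hconv (hPmem (x - lam • w))
    (hPproj (x - lam • w)) hx
  set z := P (x - lam • w) - x with hz
  have hu : x - lam • w - P (x - lam • w) = -(lam • w + z) := by rw [hz]; abel
  have hv : x - P (x - lam • w) = -z := by rw [hz]; abel
  rw [hu, hv, inner_neg_neg, inner_add_left, real_inner_smul_left,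
    real_inner_self_eq_norm_sq] at hvar
  have herr : lam * ⟪e, z⟫ ≤ σ * ‖z‖ ^ 2 := by
    calc lam * ⟪e, z⟫ ≤ lam * (‖e‖ * ‖z‖) := by gcongr; exact real_inner_le_norm e z
      _ = lam * ‖e‖ * ‖z‖ := by ring
      _ ≤ σ * ‖z‖ * ‖z‖ := by gcongr
      _ = σ * ‖z‖ ^ 2 := by ring
  rw [neg_mul, div_mul_eq_mul_div, ← neg_div, le_div_iff₀ hlam, inner_add_left]
  linarith
end

section
/- Let E be a real inner product space that is a complete normed space, let Ω ⊆ E be a nonempty closed convex set, let T > 0, and let x : ℝ → E and y : ℝ → E be such that x is differentiable on [0,T] with x′(t) = y(t) − x(t) for all t ∈ [0,T], y is continuous on [0,T], and y(t) ∈ Ω for all t ∈ [0,T]. If x(0) ∈ Ω, then x(t) ∈ Ω for all t ∈ [0,T]. -/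
theorem stmt10 {E : Type*} [NormedAddCommGroup E] [InnerProductSpace ℝ E]
    [CompleteSpace E]
    (Ω : Set E) (hne : Ω.Nonempty) (hcl : IsClosed Ω) (hconv : Convex ℝ Ω)
    (T : ℝ) (hT : 0 < T) (x y : ℝ → E)
    (hx : ∀ t ∈ Set.Icc (0 : ℝ) T, HasDerivAt x (y t - x t) t)
    (hy : ContinuousOn y (Set.Icc (0 : ℝ) T))
    (hyΩ : ∀ t ∈ Set.Icc (0 : ℝ) T, y t ∈ Ω)
    (hx0 : x 0 ∈ Ω) :
    ∀ t ∈ Set.Icc (0 : ℝ) T, x t ∈ Ω := by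
  intro t ht
  by_contra hxt
  obtain ⟨f, u, hfΩ, hft⟩ := geometric_hahn_banach_closed_point hconv hcl hxt
  have hderiv : ∀ s ∈ Set.Icc (0 : ℝ) T,
      HasDerivAt (fun s => Real.exp s * (f (x s) - u)) (Real.exp s * (f (y s) - u)) s := by
    intro s hs
    have hfx : HasDerivAt (fun s => f (x s)) (f (y s - x s)) s :=
      f.hasFDerivAt.comp_hasDerivAt s (hx s hs)
    refine ((Real.hasDerivAt_exp s).mul (hfx.sub_const u)).congr_deriv ?_
    rw [map_sub]
    ring
  have hanti : AntitoneOn (fun s => Real.exp s * (f (x s) - u)) (Set.Icc 0 T) := by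
    refine antitoneOn_of_deriv_nonpos (convex_Icc 0 T)
      (fun s hs => (hderiv s hs).continuousAt.continuousWithinAt)
      (fun s hs => (hderiv s (interior_subset hs)).differentiableAt.differentiableWithinAt)
      fun s hs => ?_
    rw [(hderiv s (interior_subset hs)).deriv]
    exact mul_nonpos_of_nonneg_of_nonpos (Real.exp_pos s).le
      (sub_nonpos.2 (hfΩ _ (hyΩ s (interior_subset hs))).le)
  have hle : Real.exp t * (f (x t) - u) ≤ Real.exp 0 * (f (x 0) - u) :=
    hanti (Set.left_mem_Icc.2 hT.le) ht ht.1
  have hpos : 0 < Real.exp t * (f (x t) - u) := mul_pos (Real.exp_pos t) (sub_pos.2 hft)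
  rw [Real.exp_zero, one_mul] at hle
  linarith [hfΩ _ hx0]
end

section
/- Let E be a real inner product space that is a complete normed space, let Ω ⊆ E be a nonempty closed convex set, let T > 0, and let x : ℝ → E and y : ℝ → E be such that x is differentiable on [0,T] with x′(t) = y(t) − x(t) for all t ∈ [0,T], y is continuous on [0,T], and y(t) ∈ Ω for all t ∈ [0,T]. Then dist(x(t), Ω) ≤ e^{−t} · dist(x(0), Ω) for all t ∈ [0,T], where dist denotes the distance from a point to the set Ω. -/
/-- The average of a continuous curve in a closed convex set stays in the set. -/
theorem Convex.intervalIntegral_unit_mem {E : Type*} [NormedAddCommGroup E] [NormedSpace ℝ E]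
    [CompleteSpace E] {s : Set E} (hs : Convex ℝ s) (hsc : IsClosed s) {f : ℝ → E}
    (hf : ContinuousOn f (Set.Icc 0 1)) (hfs : ∀ u ∈ Set.Icc (0 : ℝ) 1, f u ∈ s) :
    ∫ u in (0 : ℝ)..1, f u ∈ s := by
  have h := hs.set_average_mem (μ := MeasureTheory.volume) (t := Set.Ioc (0 : ℝ) 1) (f := f) hsc
    (by simp) (by simp)
    (MeasureTheory.ae_restrict_of_forall_mem measurableSet_Ioc
      fun u hu => hfs u (Set.Ioc_subset_Icc_self hu))
    (hf.integrableOn_Icc.mono_set Set.Ioc_subset_Icc_self)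
  rw [intervalIntegral.integral_of_le zero_le_one]
  simpa [MeasureTheory.setAverage_eq] using h

/-- Variation of constants for `x' = y - x` with `y` valued in a closed convex set: the solution
is a convex combination of its initial value and a point of the set. -/
theorem exists_mem_exp_combination_of_hasDerivAt {E : Type*} [NormedAddCommGroup E]
    [NormedSpace ℝ E] [CompleteSpace E] {s : Set E} (hs : Convex ℝ s) (hsc : IsClosed s)
    {t : ℝ} (ht : 0 ≤ t) {x y : ℝ → E}
    (hx : ∀ r ∈ Set.Icc 0 t, HasDerivAt x (y r - x r) r)
    (hy : ContinuousOn y (Set.Icc 0 t)) (hys : ∀ r ∈ Set.Icc 0 t, y r ∈ s) :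
    ∃ c ∈ s, x t = Real.exp (-t) • x 0 + (1 - Real.exp (-t)) • c := by
  set m : ℝ := Real.exp t - 1 with hm
  have hm0 : 0 ≤ m := by have := Real.one_le_exp ht; linarith
  have hpos : ∀ u ∈ Set.Icc (0 : ℝ) 1, 0 < 1 + u * m := fun u hu => by
    have := mul_nonneg hu.1 hm0; linarith
  have hmaps : Set.MapsTo (fun u => Real.log (1 + u * m)) (Set.Icc 0 1) (Set.Icc 0 t) := by
    intro u hu
    refine ⟨Real.log_nonneg (by have := mul_nonneg hu.1 hm0; linarith), ?_⟩
    rw [Real.log_le_iff_le_exp (hpos u hu)]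
    have := mul_le_mul_of_nonneg_right hu.2 hm0
    linarith
  have hcont : ContinuousOn (fun u => y (Real.log (1 + u * m))) (Set.Icc 0 1) :=
    hy.comp (ContinuousOn.log (by fun_prop) fun u hu => (hpos u hu).ne') hmaps
  refine ⟨∫ u in (0 : ℝ)..1, y (Real.log (1 + u * m)),
    hs.intervalIntegral_unit_mem hsc hcont fun u hu => hys _ (hmaps hu), ?_⟩
  have hderiv : ∀ u ∈ Set.uIcc (0 : ℝ) 1,
      HasDerivAt (fun u => (1 + u * m) • x (Real.log (1 + u * m)))
        (m • y (Real.log (1 + u * m))) u := by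
    intro u hu
    rw [Set.uIcc_of_le zero_le_one] at hu
    have hlin : HasDerivAt (fun u : ℝ => 1 + u * m) m u := by
      simpa using ((hasDerivAt_id u).mul_const m).const_add 1
    have hne := (hpos u hu).ne'
    have h := hlin.smul ((hx _ (hmaps hu)).scomp u (hlin.log hne))
    refine h.congr_deriv ?_
    simp only [Function.comp_apply, smul_smul, mul_div_cancel₀ _ hne, smul_sub]
    abel
  have hint := intervalIntegral.integral_eq_sub_of_hasDerivAt hderiv
    ((hcont.const_smul m).intervalIntegrable_of_Icc zero_le_one)
  rw [intervalIntegral.integral_smul] at hint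
  have he : Real.exp (-t) * Real.exp t = 1 := by rw [← Real.exp_add]; simp
  have h1 : 1 + 1 * m = Real.exp t := by rw [hm]; ring
  have h2 : 1 - Real.exp (-t) = Real.exp (-t) * m := by rw [hm]; linear_combination -he
  rw [h2, mul_smul, hint, h1]
  simp [smul_sub, smul_smul, he]

theorem stmt11 {E : Type*} [NormedAddCommGroup E] [InnerProductSpace ℝ E]
    [CompleteSpace E]
    (Ω : Set E) (hne : Ω.Nonempty) (hcl : IsClosed Ω) (hconv : Convex ℝ Ω)
    (T : ℝ) (hT : 0 < T) (x y : ℝ → E)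
    (hx : ∀ t ∈ Set.Icc (0 : ℝ) T, HasDerivAt x (y t - x t) t)
    (hy : ContinuousOn y (Set.Icc (0 : ℝ) T))
    (hyΩ : ∀ t ∈ Set.Icc (0 : ℝ) T, y t ∈ Ω) :
    ∀ t ∈ Set.Icc (0 : ℝ) T,
      Metric.infDist (x t) Ω ≤ Real.exp (-t) * Metric.infDist (x 0) Ω := by
  intro t ht
  have hsub : Set.Icc 0 t ⊆ Set.Icc 0 T := Set.Icc_subset_Icc_right ht.2
  obtain ⟨c, hc, hxt⟩ := exists_mem_exp_combination_of_hasDerivAt hconv hcl ht.1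
    (fun r hr => hx r (hsub hr)) (hy.mono hsub) (fun r hr => hyΩ r (hsub hr))
  have hexp : Real.exp (-t) ≤ 1 := Real.exp_le_one_iff.2 (by linarith [ht.1])
  rw [← div_le_iff₀' (Real.exp_pos _), Metric.le_infDist hne]
  intro p hp
  rw [div_le_iff₀' (Real.exp_pos _)]
  refine (Metric.infDist_le_dist_of_mem
    (hconv hp hc (Real.exp_pos (-t)).le (sub_nonneg.2 hexp) (by ring))).trans_eq ?_
  rw [hxt, dist_add_right, dist_smul₀, Real.norm_of_nonneg (Real.exp_pos _).le]
end

section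
/- Let f, g : ℝⁿ → ℝ be differentiable with gradients ∇f, ∇g (Euclidean inner product), let Ω ⊆ ℝⁿ be a nonempty closed convex set with metric projection P_Ω, let λ > 0, σ ∈ (0,1), L̄ ≥ 0, and t₀ < t₁. Let x : ℝ → ℝⁿ be differentiable on [t₀,t₁] with x(t₀) = xᵏ ∈ Ω, x′(t) = P_Ω(x(t) − λ(∇f(x(t)) + ∇g(xᵏ))) − x(t) for all t ∈ [t₀,t₁], and suppose x(t) ∈ Ω for all t ∈ [t₀,t₁]. Define z̄(t) = P_Ω(x(t) − λ(∇f(x(t)) + ∇g(xᵏ))) − x(t). If for all t ∈ [t₀,t₁] one has ‖∇g(x(t)) − ∇g(xᵏ)‖ ≤ L̄‖x(t) − xᵏ‖ and λL̄‖x(t) − xᵏ‖ ≤ σ‖z̄(t)‖, then for every t ∈ [t₀,t₁] the derivative of t ↦ f(x(t)) + g(x(t)) is at most −((1−σ)/λ)‖z̄(t)‖². -/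
/-- The variational inequality characterising a nearest point of a convex set. -/
theorem inner_sub_nearest_nonpos {E : Type*} [NormedAddCommGroup E] [InnerProductSpace ℝ E]
    {K : Set E} (hK : Convex ℝ K) {u p : E} (hp : p ∈ K) (hmin : ∀ v ∈ K, ‖u - p‖ ≤ ‖u - v‖)
    {v : E} (hv : v ∈ K) : inner ℝ (u - p) (v - p) ≤ 0 := by
  refine (norm_eq_iInf_iff_real_inner_le_zero hK hp).1 (le_antisymm ?_ ?_) v hv
  · have : Nonempty K := ⟨⟨p, hp⟩⟩
    exact le_ciInf fun w => hmin w w.2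
  · exact ciInf_le (f := fun w : K => ‖u - w‖)
      ⟨0, Set.forall_mem_range.2 fun _ => norm_nonneg _⟩ ⟨p, hp⟩

/-- The projected step `p - x` along `-c • w` satisfies `‖p - x‖ ^ 2 + c * ⟪w, p - x⟫ ≤ 0`. -/
theorem norm_sq_add_inner_projected_step_nonpos {E : Type*} [NormedAddCommGroup E]
    [InnerProductSpace ℝ E] {K : Set E} (hK : Convex ℝ K) {x w p : E} {c : ℝ} (hx : x ∈ K)
    (hp : p ∈ K) (hmin : ∀ v ∈ K, ‖x - c • w - p‖ ≤ ‖x - c • w - v‖) :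
    ‖p - x‖ ^ 2 + c * inner ℝ w (p - x) ≤ 0 := by
  have h := inner_sub_nearest_nonpos hK hp hmin hx
  have e1 : x - c • w - p = -((p - x) + c • w) := by abel
  rw [e1, ← neg_sub p x, inner_neg_neg, inner_add_left, real_inner_self_eq_norm_sq,
    real_inner_smul_left] at h
  exact h

theorem stmt12 (n : ℕ) (f g : EuclideanSpace ℝ (Fin n) → ℝ)
    (f' g' : EuclideanSpace ℝ (Fin n) → EuclideanSpace ℝ (Fin n))
    (hf : ∀ y, HasGradientAt f (f' y) y) (hg : ∀ y, HasGradientAt g (g' y) y)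
    (Ω : Set (EuclideanSpace ℝ (Fin n)))
    (hne : Ω.Nonempty) (hcl : IsClosed Ω) (hconv : Convex ℝ Ω)
    (P : EuclideanSpace ℝ (Fin n) → EuclideanSpace ℝ (Fin n))
    (hPmem : ∀ u, P u ∈ Ω)
    (hPproj : ∀ u, ∀ v ∈ Ω, ‖u - P u‖ ≤ ‖u - v‖)
    (lam σ Lbar : ℝ) (hlam : 0 < lam) (hσ : σ ∈ Set.Ioo (0 : ℝ) 1) (hL : 0 ≤ Lbar)
    (t₀ t₁ : ℝ) (ht : t₀ < t₁) (x : ℝ → EuclideanSpace ℝ (Fin n))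
    (hx0 : x t₀ ∈ Ω)
    (hx : ∀ t ∈ Set.Icc t₀ t₁,
      HasDerivAt x (P (x t - lam • (f' (x t) + g' (x t₀))) - x t) t)
    (hxΩ : ∀ t ∈ Set.Icc t₀ t₁, x t ∈ Ω)
    (hLip : ∀ t ∈ Set.Icc t₀ t₁,
      ‖g' (x t) - g' (x t₀)‖ ≤ Lbar * ‖x t - x t₀‖)
    (htrig : ∀ t ∈ Set.Icc t₀ t₁,
      lam * Lbar * ‖x t - x t₀‖ ≤ σ * ‖P (x t - lam • (f' (x t) + g' (x t₀))) - x t‖) :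
    ∀ t ∈ Set.Icc t₀ t₁,
      deriv (fun s => f (x s) + g (x s)) t
        ≤ -((1 - σ) / lam) * ‖P (x t - lam • (f' (x t) + g' (x t₀))) - x t‖ ^ 2 := by
  intro t htI
  have hvar := norm_sq_add_inner_projected_step_nonpos hconv (hxΩ t htI) (hPmem _)
    (hPproj (x t - lam • (f' (x t) + g' (x t₀))))
  have hxt := hx t htI
  have hl := hLip t htI
  have htr := htrig t htI
  set z := P (x t - lam • (f' (x t) + g' (x t₀))) - x t
  have hd : HasDerivAt (fun s => f (x s) + g (x s))
      (inner ℝ (f' (x t)) z + inner ℝ (g' (x t)) z) t := by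
    have hfx : HasDerivAt (fun s => f (x s)) (inner ℝ (f' (x t)) z) t :=
      (hf (x t)).hasFDerivAt.comp_hasDerivAt t hxt
    have hgx : HasDerivAt (fun s => g (x s)) (inner ℝ (g' (x t)) z) t :=
      (hg (x t)).hasFDerivAt.comp_hasDerivAt t hxt
    exact hfx.add hgx
  rw [hd.deriv]
  have hcs : inner ℝ (g' (x t) - g' (x t₀)) z ≤ Lbar * ‖x t - x t₀‖ * ‖z‖ :=
    (real_inner_le_norm _ _).trans (mul_le_mul_of_nonneg_right hl (norm_nonneg z))
  have hz := mul_le_mul_of_nonneg_right htr (norm_nonneg z)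
  have hlcs := mul_le_mul_of_nonneg_left hcs hlam.le
  rw [inner_sub_left] at hlcs
  rw [inner_add_left] at hvar
  have hrhs : -((1 - σ) / lam) * ‖z‖ ^ 2 = (-(1 - σ) * ‖z‖ ^ 2) / lam := by ring
  rw [hrhs, le_div_iff₀ hlam]
  linarith
end

section
/- Let a < b be real numbers and let P : ℝ → ℝ, P(y) = max(a, min(y, b)), denote the projection onto [a,b]. Let φ : ℝ → ℝ be twice continuously differentiable with 0 ≤ φ″(y) ≤ H for all y ∈ [a,b], where H > 0, let c ∈ ℝ, 0 < λ ≤ 1/H, and t₀ < t₁. Let x : ℝ → ℝ be differentiable on [t₀,t₁] with x(t₀) ∈ [a,b] and x′(t) = P(x(t) − λ(φ′(x(t)) + c)) − x(t) for all t ∈ [t₀,t₁]. Define z̄(t) = P(x(t) − λ(φ′(x(t)) + c)) − x(t). Then for all t ∈ [t₀,t₁], |x(t) − x(t₀)| ≤ |z̄(t)| · (e^{t−t₀} − 1). -/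
/-- If `0 ≤ g₂ - g₁ ≤ y₂ - y₁`, where `g₁` and `g₂` are the scaled gradients at `y₁` and `y₂`, then the projected residual changes by at most `y₂ - y₁`. -/
lemma abs_clamp_residual_sub_le {a b y₁ y₂ g₁ g₂ : ℝ} (h₀ : 0 ≤ g₂ - g₁)
    (h₁ : g₂ - g₁ ≤ y₂ - y₁) :
    |(max a (min (y₂ - g₂) b) - y₂) - (max a (min (y₁ - g₁) b) - y₁)| ≤ y₂ - y₁ := by
  have hmono : max a (min (y₁ - g₁) b) ≤ max a (min (y₂ - g₂) b) :=
    max_le_max_left a (min_le_min_right b (by linarith))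
  have hlip : max a (min (y₂ - g₂) b) ≤ max a (min (y₁ - g₁) b) + (y₂ - y₁) := by
    have hy : y₂ - g₂ ≤ (y₁ - g₁) + (y₂ - y₁) := by linarith
    have hd : 0 ≤ y₂ - y₁ := h₀.trans h₁
    rw [max_add, min_add]
    exact max_le_max (by linarith) (min_le_min hy (by linarith))
  rw [abs_le]
  constructor <;> linarith

/-- The increments of `lam * (f + c)` lie between `0` and the increment of the argument when
`f' ∈ [0, H]` and `lam ≤ 1 / H`. -/
lemma scaled_increment_mem_Icc {a b H c lam : ℝ} {f : ℝ → ℝ} (hf : Differentiable ℝ f)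
    (hH : 0 < H) (hf' : ∀ y ∈ Set.Icc a b, deriv f y ∈ Set.Icc (0 : ℝ) H)
    (hlam : 0 < lam) (hlamH : lam ≤ 1 / H) {y₁ y₂ : ℝ} (hy₁ : y₁ ∈ Set.Icc a b)
    (hy₂ : y₂ ∈ Set.Icc a b) (h : y₁ ≤ y₂) :
    lam * (f y₂ + c) - lam * (f y₁ + c) ∈ Set.Icc 0 (y₂ - y₁) := by
  rcases h.eq_or_lt with rfl | hlt
  · simp
  obtain ⟨ξ, hξ, hslope⟩ := exists_deriv_eq_slope f hlt hf.continuous.continuousOn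
    hf.differentiableOn
  obtain ⟨h₀, h₁⟩ := hf' ξ ⟨hy₁.1.trans hξ.1.le, hξ.2.le.trans hy₂.2⟩
  have hd : 0 < y₂ - y₁ := sub_pos.mpr hlt
  have hincr : f y₂ - f y₁ = deriv f ξ * (y₂ - y₁) := by
    rw [hslope, div_mul_cancel₀ _ hd.ne']
  have hlam1 : lam * deriv f ξ ≤ 1 :=
    (mul_le_mul_of_nonneg_left h₁ hlam.le).trans ((le_div_iff₀ hH).mp hlamH)
  have heq : lam * (f y₂ + c) - lam * (f y₁ + c) = lam * deriv f ξ * (y₂ - y₁) := by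
    rw [mul_assoc, ← hincr]
    ring
  rw [heq]
  exact ⟨by positivity, mul_le_of_le_one_left hd.le hlam1⟩

/-- The projected residual is `1`-Lipschitz on `[a, b]`. -/
lemma abs_projected_residual_sub_le {a b H c lam : ℝ} {f : ℝ → ℝ} (hf : Differentiable ℝ f)
    (hH : 0 < H) (hf' : ∀ y ∈ Set.Icc a b, deriv f y ∈ Set.Icc (0 : ℝ) H)
    (hlam : 0 < lam) (hlamH : lam ≤ 1 / H) {y₁ y₂ : ℝ} (hy₁ : y₁ ∈ Set.Icc a b)
    (hy₂ : y₂ ∈ Set.Icc a b) :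
    |(max a (min (y₂ - lam * (f y₂ + c)) b) - y₂) -
      (max a (min (y₁ - lam * (f y₁ + c)) b) - y₁)| ≤ |y₂ - y₁| := by
  rcases le_total y₁ y₂ with h | h
  · obtain ⟨h₀, h₁⟩ := scaled_increment_mem_Icc (c := c) hf hH hf' hlam hlamH hy₁ hy₂ h
    exact (abs_clamp_residual_sub_le h₀ h₁).trans (le_abs_self _)
  · obtain ⟨h₀, h₁⟩ := scaled_increment_mem_Icc (c := c) hf hH hf' hlam hlamH hy₂ hy₁ h
    rw [abs_sub_comm, abs_sub_comm y₂]
    exact (abs_clamp_residual_sub_le h₀ h₁).trans (le_abs_self _)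

/-- A solution of `x' = u - x` with `u ≥ a` stays above `a`. -/
lemma le_of_hasDerivAt_sub_self {a t₀ t₁ : ℝ} {x u : ℝ → ℝ}
    (hx : ∀ t ∈ Set.Icc t₀ t₁, HasDerivAt x (u t - x t) t)
    (hu : ∀ t ∈ Set.Icc t₀ t₁, a ≤ u t) (hx0 : a ≤ x t₀) :
    ∀ t ∈ Set.Icc t₀ t₁, a ≤ x t := by
  have hd : ∀ t ∈ Set.Icc t₀ t₁,
      HasDerivAt (fun s => Real.exp s * (x s - a)) (Real.exp t * (u t - a)) t := by
    intro t ht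
    exact ((Real.hasDerivAt_exp t).fun_mul ((hx t ht).sub_const a)).congr_deriv (by ring)
  have hmono : MonotoneOn (fun s => Real.exp s * (x s - a)) (Set.Icc t₀ t₁) := by
    refine monotoneOn_of_deriv_nonneg (convex_Icc _ _)
      (fun t ht => (hd t ht).continuousAt.continuousWithinAt)
      (fun t ht => (hd t (interior_subset ht)).differentiableAt.differentiableWithinAt) ?_
    intro t ht
    rw [(hd t (interior_subset ht)).deriv]
    exact mul_nonneg (Real.exp_pos t).le (sub_nonneg.mpr (hu t (interior_subset ht)))
  intro t ht
  have hle := hmono ⟨le_rfl, ht.1.trans ht.2⟩ ht ht.1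
  have h0 : 0 ≤ Real.exp t * (x t - a) :=
    (mul_nonneg (Real.exp_pos t₀).le (sub_nonneg.mpr hx0)).trans hle
  exact sub_nonneg.mp (nonneg_of_mul_nonneg_right h0 (Real.exp_pos t))

/-- A solution of `x' = u - x` with `u` valued in `[a, b]` stays in `[a, b]`. -/
lemma mem_Icc_of_hasDerivAt_sub_self {a b t₀ t₁ : ℝ} {x u : ℝ → ℝ}
    (hx : ∀ t ∈ Set.Icc t₀ t₁, HasDerivAt x (u t - x t) t)
    (hu : ∀ t ∈ Set.Icc t₀ t₁, u t ∈ Set.Icc a b) (hx0 : x t₀ ∈ Set.Icc a b) :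
    ∀ t ∈ Set.Icc t₀ t₁, x t ∈ Set.Icc a b := by
  intro t ht
  refine ⟨le_of_hasDerivAt_sub_self hx (fun s hs => (hu s hs).1) hx0.1 t ht, ?_⟩
  refine neg_le_neg_iff.mp (le_of_hasDerivAt_sub_self (x := fun s => -x s) (u := fun s => -u s)
    (fun s hs => ?_) (fun s hs => neg_le_neg (hu s hs).2) (neg_le_neg hx0.2) t ht)
  exact (hx s hs).fun_neg.congr_deriv (by ring)

/-- Backward Grönwall estimate: if the velocity `v` of `x` varies by at most the displacement,
then the displacement up to time `T` is controlled by the final velocity. -/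
lemma abs_sub_le_of_abs_velocity_sub_le {t₀ T : ℝ} (hT : t₀ ≤ T) {x v : ℝ → ℝ}
    (hx : ∀ t ∈ Set.Icc t₀ T, HasDerivAt x (v t) t)
    (hv : ∀ t ∈ Set.Icc t₀ T, |v t - v T| ≤ |x t - x T|) :
    |x T - x t₀| ≤ |v T| * (Real.exp (T - t₀) - 1) := by
  have hmem : ∀ s ∈ Set.Icc 0 (T - t₀), T - s ∈ Set.Icc t₀ T := fun s hs =>
    ⟨by linarith [hs.2], by linarith [hs.1]⟩
  have hd : ∀ s ∈ Set.Icc 0 (T - t₀),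
      HasDerivAt (fun r => x (T - r) - x T) (-v (T - s)) s := fun s hs =>
    ((hx _ (hmem s hs)).comp_const_sub T s).sub_const _
  have key := norm_le_gronwallBound_of_norm_deriv_right_le (δ := 0) (K := 1) (ε := |v T|)
    (fun s hs => (hd s hs).continuousAt.continuousWithinAt)
    (fun s hs => (hd s (Set.Ico_subset_Icc_self hs)).hasDerivWithinAt)
    (by simp) (fun s hs => ?_) (T - t₀) ⟨sub_nonneg.mpr hT, le_rfl⟩
  · rw [gronwallBound_of_K_ne_0 one_ne_zero] at key
    simpa [abs_sub_comm] using key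
  · have h := hv _ (hmem s (Set.Ico_subset_Icc_self hs))
    have h' := abs_sub_abs_le_abs_sub (v (T - s)) (v T)
    rw [Real.norm_eq_abs, Real.norm_eq_abs, abs_neg]
    linarith

theorem stmt15 (a b : ℝ) (hab : a < b) (φ : ℝ → ℝ) (hφ : ContDiff ℝ 2 φ)
    (H : ℝ) (hH : 0 < H)
    (hφ'' : ∀ y ∈ Set.Icc a b, deriv (deriv φ) y ∈ Set.Icc (0 : ℝ) H)
    (c lam t₀ t₁ : ℝ) (hlam : 0 < lam) (hlamH : lam ≤ 1 / H) (ht : t₀ < t₁)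
    (x : ℝ → ℝ) (hx0 : x t₀ ∈ Set.Icc a b)
    (hx : ∀ t ∈ Set.Icc t₀ t₁,
      HasDerivAt x (max a (min (x t - lam * (deriv φ (x t) + c)) b) - x t) t) :
    ∀ t ∈ Set.Icc t₀ t₁,
      |x t - x t₀| ≤
        |max a (min (x t - lam * (deriv φ (x t) + c)) b) - x t| *
          (Real.exp (t - t₀) - 1) := by
  intro T hT
  have hf : Differentiable ℝ (deriv φ) := hφ.differentiable_deriv_two
  have hmem := mem_Icc_of_hasDerivAt_sub_self hx
    (fun _ _ => ⟨le_max_left a _, max_le hab.le (min_le_right _ b)⟩) hx0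
  have hsub : Set.Icc t₀ T ⊆ Set.Icc t₀ t₁ := Set.Icc_subset_Icc_right hT.2
  exact abs_sub_le_of_abs_velocity_sub_le hT.1
    (v := fun t => max a (min (x t - lam * (deriv φ (x t) + c)) b) - x t)
    (fun t ht => hx t (hsub ht))
    (fun t ht => abs_projected_residual_sub_le hf hH hφ'' hlam hlamH (hmem T hT)
      (hmem _ (hsub ht)))
end
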